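/- Suppose y^n ∈ 𝒴^n satisfies |P_{y^n}(k) − p̄(y_k|x₁)| ≤ ε for all k, for every label index l ∈ {1,…,M} the training vector ŷ_l ∈ 𝒴^{nt} satisfies |P_{ŷ_l}(k) − p̄(y_k|x_l)| ≤ ε·t^{−1/3} for all k, and ε < ‖P̄_i − P̄₁‖_r / (2·(1 + t^{−1/3})·K^{1/r}) for every i ≠ 1. Then for every i ≠ 1, ‖P_{y^n} − P_{ŷ₁}‖_r < ‖P_{y^n} − P_{ŷ_i}‖_r; that is, the nearest-empirical-distribution classifier assigns label x₁ to y^n. -/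

import Mathlib

open Finset

/-- Empirical distribution of a vector `v : Fin N → Fin K`. -/
noncomputable def empDist {K N : ℕ} (v : Fin N → Fin K) (k : Fin K) : ℝ :=
  ((Finset.univ.filter (fun j => v j = k)).card : ℝ) / N

/-- The ℓ^r norm on ℝ^K. -/
noncomputable def lpNorm {K : ℕ} (r : ℝ) (u : Fin K → ℝ) : ℝ :=
  (∑ k, |u k| ^ r) ^ (1 / r)

theorem lpNorm_add_le_aux {K : ℕ} (r : ℝ) (hr : 1 ≤ r) (u v : Fin K → ℝ) :
    lpNorm r (fun k => u k + v k) ≤ lpNorm r u + lpNorm r v := by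
  unfold lpNorm
  exact Real.Lp_add_le Finset.univ u v hr

theorem lpNorm_le_const_aux {K : ℕ} (r : ℝ) (hr : 1 ≤ r) (u : Fin K → ℝ) (c : ℝ)
    (hc : 0 ≤ c) (h : ∀ k, |u k| ≤ c) : lpNorm r u ≤ c * (K : ℝ) ^ (1 / r) := by
  unfold lpNorm
  have h0 : 0 < r := by linarith
  have h1 : ∑ k, |u k| ^ r ≤ (K : ℝ) * c ^ r := by
    calc ∑ k, |u k| ^ r ≤ ∑ _k : Fin K, c ^ r :=
          Finset.sum_le_sum fun k _ => Real.rpow_le_rpow (abs_nonneg _) (h k) h0.le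
      _ = (K : ℝ) * c ^ r := by simp
  calc (∑ k, |u k| ^ r) ^ (1 / r) ≤ ((K : ℝ) * c ^ r) ^ (1 / r) :=
        Real.rpow_le_rpow (Finset.sum_nonneg fun k _ => Real.rpow_nonneg (abs_nonneg _) _) h1
          (by positivity)
    _ = c * (K : ℝ) ^ (1 / r) := by
        rw [Real.mul_rpow (by positivity) (by positivity), ← Real.rpow_mul hc,
          mul_one_div_cancel h0.ne', Real.rpow_one, mul_comm]

theorem stmt_11 {K n t M : ℕ} (hK : 1 ≤ K) (hn : 1 ≤ n) (ht : 1 ≤ t) (hM : 2 ≤ M)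
    (r : ℝ) (hr : 1 ≤ r) (ε : ℝ) (hε : 0 < ε)
    (p : Fin M → Fin n → Fin K → ℝ)
    (hp0 : ∀ l i k, 0 ≤ p l i k) (hp1 : ∀ l i, ∑ k, p l i k = 1)
    (pbar : Fin M → Fin K → ℝ) (hpbar : ∀ l k, pbar l k = (∑ i, p l i k) / n)
    (x1 : Fin M)                          -- the true label
    (y : Fin n → Fin K)                   -- the observed vector
    (yh : Fin M → Fin (n * t) → Fin K)    -- one training vector per label
    (hy : ∀ k, |empDist y k - pbar x1 k| ≤ ε)
    (hyh : ∀ l k, |empDist (yh l) k - pbar l k| ≤ ε * (t : ℝ) ^ (-(1/3 : ℝ)))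
    (hsep : ∀ i, i ≠ x1 →
      ε < lpNorm r (fun k => pbar i k - pbar x1 k) /
            (2 * (1 + (t : ℝ) ^ (-(1/3 : ℝ))) * (K : ℝ) ^ (1 / r))) :
    ∀ i, i ≠ x1 →
      lpNorm r (fun k => empDist y k - empDist (yh x1) k) <
        lpNorm r (fun k => empDist y k - empDist (yh i) k) := by
  intro i hi
  have hs := hsep i hi
  have hKp : (0 : ℝ) < (K : ℝ) ^ (1 / r) :=
    Real.rpow_pos_of_pos (by exact_mod_cast hK) _
  have hs0 : (0 : ℝ) ≤ (t : ℝ) ^ (-(1/3 : ℝ)) := by positivity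
  generalize (t : ℝ) ^ (-(1/3 : ℝ)) = s at *
  rw [lt_div_iff₀ (by positivity)] at hs
  have hc : 0 ≤ ε + ε * s := by positivity
  have hA := lpNorm_le_const_aux r hr (fun k => empDist y k - empDist (yh x1) k) _ hc (by
    intro k
    have h1 := abs_le.1 (hy k)
    have h2 := abs_le.1 (hyh x1 k)
    exact abs_le.2 ⟨by linarith [h1.1, h2.2], by linarith [h1.2, h2.1]⟩)
  have hB := lpNorm_le_const_aux r hr
    (fun k => (pbar i k - pbar x1 k) + (empDist y k - empDist (yh i) k)) _ hc (by
    intro k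
    have h1 := abs_le.1 (hy k)
    have h2 := abs_le.1 (hyh i k)
    exact abs_le.2 ⟨by linarith [h1.1, h2.2], by linarith [h1.2, h2.1]⟩)
  have hC := lpNorm_add_le_aux r hr
    (fun k => (pbar i k - pbar x1 k) + (empDist y k - empDist (yh i) k))
    (fun k => -(empDist y k - empDist (yh i) k))
  have e1 : lpNorm r (fun k => -(empDist y k - empDist (yh i) k))
      = lpNorm r (fun k => empDist y k - empDist (yh i) k) := by
    simp only [lpNorm, abs_neg]
  simp only [add_neg_cancel_right] at hC
  rw [e1] at hC
  nlinarith
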